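/- arXiv:1204.0366 — 2 statements merged into one kernel-verified Lean document; each statement's English description precedes it below -/
import Mathlib

section
/- If the partial transpose over qubit C of the three-qubit graph-diagonal state ρ_ABC = CZ_{AC}(ρ_AB ⊗ ρ_C)CZ_{AC} is positive semidefinite (with all s_x ≥ 0 and s ≥ 0), then ρ_ABC is separable across the bipartition C | AB, i.e. it can be written as a convex combination of products σ_C ⊗ σ_{AB} of positive semidefinite operators. -/
open Matrix Kronecker Complex ComplexOrder

noncomputable section

/-- Pauli X -/
def σX : Matrix (Fin 2) (Fin 2) ℂ := !![0, 1; 1, 0]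
/-- Pauli Y -/
def σY : Matrix (Fin 2) (Fin 2) ℂ := !![0, -Complex.I; Complex.I, 0]
/-- Pauli Z -/
def σZ : Matrix (Fin 2) (Fin 2) ℂ := !![1, 0; 0, -1]

/-- sign (-1)^a for a bit -/
def sgn (a : Bool) : ℝ := if a then -1 else 1

/-- three-qubit index type, qubit ordering (C, A, B) -/
abbrev Q3 := Fin 2 × Fin 2 × Fin 2

/-- the operator M_C ⊗ M_A ⊗ M_B on the three qubits ordered C, A, B -/
def op3 (MC MA MB : Matrix (Fin 2) (Fin 2) ℂ) : Matrix Q3 Q3 ℂ :=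
  fun i j => MC i.1 j.1 * MA i.2.1 j.2.1 * MB i.2.2 j.2.2

/-- tensor product N_C ⊗ M_{AB} of a one-qubit operator (on C) with a two-qubit operator (on A,B) -/
def tensC_AB (N : Matrix (Fin 2) (Fin 2) ℂ)
    (M : Matrix (Fin 2 × Fin 2) (Fin 2 × Fin 2) ℂ) : Matrix Q3 Q3 ℂ :=
  fun i j => N i.1 j.1 * M i.2 j.2

/-- partial transpose over qubit C -/
def ptC (M : Matrix Q3 Q3 ℂ) : Matrix Q3 Q3 ℂ := fun i j => M (j.1, i.2) (i.1, j.2)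
/-- partial transpose over qubit A -/
def ptA (M : Matrix Q3 Q3 ℂ) : Matrix Q3 Q3 ℂ :=
  fun i j => M (i.1, (j.2.1, i.2.2)) (j.1, (i.2.1, j.2.2))
/-- partial transpose over qubit B -/
def ptB (M : Matrix Q3 Q3 ℂ) : Matrix Q3 Q3 ℂ :=
  fun i j => M (i.1, (i.2.1, j.2.2)) (j.1, (j.2.1, i.2.2))

/-- partial transpose over the first qubit of a two-qubit operator -/
def pt1 (M : Matrix (Fin 2 × Fin 2) (Fin 2 × Fin 2) ℂ) : Matrix (Fin 2 × Fin 2) (Fin 2 × Fin 2) ℂ :=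
  fun i j => M (j.1, i.2) (i.1, j.2)
/-- partial transpose over the second qubit of a two-qubit operator -/
def pt2 (M : Matrix (Fin 2 × Fin 2) (Fin 2 × Fin 2) ℂ) : Matrix (Fin 2 × Fin 2) (Fin 2 × Fin 2) ℂ :=
  fun i j => M (i.1, j.2) (j.1, i.2)

/-- Bell-diagonal two-qubit operator (1/4)(I + s01 X⊗X + s10 Z⊗Z + s11 Y⊗Y) -/
def bellDiag (s01 s10 s11 : ℝ) : Matrix (Fin 2 × Fin 2) (Fin 2 × Fin 2) ℂ :=
  (1/4 : ℂ) • (1 + (s01 : ℂ) • (σX ⊗ₖ σX) + (s10 : ℂ) • (σZ ⊗ₖ σZ) + (s11 : ℂ) • (σY ⊗ₖ σY))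

/-- single-qubit state (1/2)(I + s X) -/
def rhoC (s : ℝ) : Matrix (Fin 2) (Fin 2) ℂ := (1/2 : ℂ) • (1 + (s : ℂ) • σX)

/-- controlled-phase gate between qubits C and A inside the three-qubit space -/
def CZCA : Matrix Q3 Q3 ℂ :=
  fun i j => if i = j then (if i.1 = 1 ∧ i.2.1 = 1 then -1 else 1) else 0
/-- controlled-phase gate between qubits A and B inside the three-qubit space -/
def CZAB : Matrix Q3 Q3 ℂ :=
  fun i j => if i = j then (if i.2.1 = 1 ∧ i.2.2 = 1 then -1 else 1) else 0

/-- lift of a two-qubit operator on (C,A) to the three-qubit space (identity on B) -/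
def liftCA (V : Matrix (Fin 2 × Fin 2) (Fin 2 × Fin 2) ℂ) : Matrix Q3 Q3 ℂ :=
  fun i j => V (i.1, i.2.1) (j.1, j.2.1) * (if i.2.2 = j.2.2 then 1 else 0)

/-- the state ρ_ABC = CZ_{AC} (ρ_C ⊗ ρ_AB) CZ_{AC} of the EDSS protocol -/
def rhoABC (s01 s10 s11 s : ℝ) : Matrix Q3 Q3 ℂ :=
  CZCA * tensC_AB (rhoC s) (bellDiag s01 s10 s11) * CZCA

/-- stabilizer K_C = X_C Z_A of the path graph C–A–B -/
def KC : Matrix Q3 Q3 ℂ := op3 σX σZ 1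
/-- stabilizer K_A = Z_C X_A Z_B of the path graph C–A–B -/
def KA : Matrix Q3 Q3 ℂ := op3 σZ σX σZ
/-- stabilizer K_B = Z_A X_B of the path graph C–A–B -/
def KB : Matrix Q3 Q3 ℂ := op3 1 σZ σX

/-- the vector |+⟩⊗|+⟩⊗|+⟩ -/
def plus3 : Q3 → ℂ := fun _ => ((1 : ℂ) / Real.sqrt 2) ^ 3

/-- the graph state of the three-vertex path C–A–B -/
def ψG : Q3 → ℂ := (CZCA * CZAB).mulVec plus3

/-- Z_x : product of Pauli-Z on the qubits indicated by the bit string x = (x_C, x_A, x_B) -/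
def Zop (x : Bool × Bool × Bool) : Matrix Q3 Q3 ℂ :=
  op3 (if x.1 then σZ else 1) (if x.2.1 then σZ else 1) (if x.2.2 then σZ else 1)

/-- the graph-state basis vector Z_x |ψ⟩ -/
def grState (x : Bool × Bool × Bool) : Q3 → ℂ := (Zop x).mulVec ψG

/-- K_x : product of the stabilizers indicated by the bit string x = (x_C, x_A, x_B) -/
def Kx (x : Bool × Bool × Bool) : Matrix Q3 Q3 ℂ :=
  (if x.1 then KC else 1) * (if x.2.1 then KA else 1) * (if x.2.2 then KB else 1)

/-- separability across the bipartition C | AB: a convex combination of products of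
positive-semidefinite, trace-one operators on C and on AB. -/
def SepCAB (M : Matrix Q3 Q3 ℂ) : Prop :=
  ∃ (n : ℕ) (p : Fin n → ℝ) (σC : Fin n → Matrix (Fin 2) (Fin 2) ℂ)
    (σAB : Fin n → Matrix (Fin 2 × Fin 2) (Fin 2 × Fin 2) ℂ),
    (∀ k, 0 ≤ p k) ∧
    (∀ k, (σC k).PosSemidef ∧ (σAB k).PosSemidef ∧ (σC k).trace = 1 ∧ (σAB k).trace = 1) ∧
    M = ∑ k, ((p k : ℝ) : ℂ) • tensC_AB (σC k) (σAB k)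

theorem SepCAB.add {M N : Matrix Q3 Q3 ℂ} (hM : SepCAB M) (hN : SepCAB N) : SepCAB (M + N) := by
  obtain ⟨m, p, σC, σAB, hp, hσ, rfl⟩ := hM
  obtain ⟨n, q, τC, τAB, hq, hτ, rfl⟩ := hN
  refine ⟨m + n, Fin.append p q, Fin.append σC τC, Fin.append σAB τAB, ?_, ?_, ?_⟩
  · intro k
    induction k using Fin.addCases <;> simp [hp, hq]
  · intro k
    induction k using Fin.addCases with
    | left k => simpa using hσ k
    | right k => simpa using hτ k
  · simp [Fin.sum_univ_add]

theorem SepCAB.smul {M : Matrix Q3 Q3 ℂ} (hM : SepCAB M) {r : ℝ} (hr : 0 ≤ r) :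
    SepCAB ((r : ℂ) • M) := by
  obtain ⟨n, p, σC, σAB, hp, hσ, rfl⟩ := hM
  refine ⟨n, fun k => r * p k, σC, σAB, fun k => mul_nonneg hr (hp k), hσ, ?_⟩
  simp [Finset.smul_sum, mul_smul]

/-- A positive semidefinite matrix is a nonnegative multiple of a positive semidefinite matrix of
trace one. -/
theorem Matrix.PosSemidef.exists_eq_smul_trace_one {ι : Type*} [Fintype ι] [DecidableEq ι]
    [Nonempty ι] {M : Matrix ι ι ℂ} (hM : M.PosSemidef) :
    ∃ (r : ℝ) (N : Matrix ι ι ℂ), 0 ≤ r ∧ N.PosSemidef ∧ N.trace = 1 ∧ M = (r : ℂ) • N := by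
  obtain ⟨r, hr, hrM⟩ := RCLike.nonneg_iff_exists_ofReal.mp hM.trace_nonneg
  rcases hr.eq_or_lt with rfl | hpos
  · obtain rfl : M = 0 := hM.trace_eq_zero_iff.mp (by simpa using hrM.symm)
    have hcard : (0 : ℝ) ≤ (Fintype.card ι : ℝ)⁻¹ := by positivity
    refine ⟨0, ((Fintype.card ι : ℝ)⁻¹ : ℝ) • 1, le_rfl, PosSemidef.one.smul hcard, ?_, by simp⟩
    simp [trace_smul]
  · refine ⟨r, (r⁻¹ : ℝ) • M, hr, hM.smul (inv_nonneg.mpr hr), ?_, ?_⟩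
    · rw [trace_smul, ← hrM]
      simp [hpos.ne']
    · ext i j
      simp [hpos.ne']

theorem SepCAB.tensC_AB {N : Matrix (Fin 2) (Fin 2) ℂ}
    {M : Matrix (Fin 2 × Fin 2) (Fin 2 × Fin 2) ℂ} (hN : N.PosSemidef) (hM : M.PosSemidef) :
    SepCAB (tensC_AB N M) := by
  obtain ⟨r, N', hr, hN', htN, rfl⟩ := hN.exists_eq_smul_trace_one
  obtain ⟨t, M', ht, hM', htM, rfl⟩ := hM.exists_eq_smul_trace_one
  refine ⟨1, fun _ => r * t, fun _ => N', fun _ => M', fun _ => mul_nonneg hr ht,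
    fun _ => ⟨hN', hM', htN, htM⟩, ?_⟩
  ext i j
  simp [_root_.tensC_AB]
  ring

theorem Matrix.posSemidef_one_add_of_involution {ι : Type*} [Fintype ι] [DecidableEq ι]
    {P : Matrix ι ι ℂ} (hP : P.IsHermitian) (hP2 : P * P = 1) : (1 + P).PosSemidef := by
  have h : 1 + P = (1 / 2 : ℝ) • ((1 + P)ᴴ * (1 + P)) := by
    rw [conjTranspose_add, conjTranspose_one, hP.eq, mul_add, add_mul, add_mul, hP2, one_mul, mul_one, one_mul]
    module
  rw [h]
  exact (posSemidef_conjTranspose_mul_self _).smul (by norm_num)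

theorem Matrix.posSemidef_one_sub_of_involution {ι : Type*} [Fintype ι] [DecidableEq ι]
    {P : Matrix ι ι ℂ} (hP : P.IsHermitian) (hP2 : P * P = 1) : (1 - P).PosSemidef := by
  rw [sub_eq_add_neg]
  exact posSemidef_one_add_of_involution hP.neg (by simpa using hP2)

/-- `1 ⊗ E + P ⊗ F = ½ ((1 + P) ⊗ (E + F) + (1 - P) ⊗ (E - F))` is separable. -/
theorem SepCAB.one_tens_add_tens {P : Matrix (Fin 2) (Fin 2) ℂ}
    {E F : Matrix (Fin 2 × Fin 2) (Fin 2 × Fin 2) ℂ} (hP : P.IsHermitian) (hP2 : P * P = 1)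
    (hadd : (E + F).PosSemidef) (hsub : (E - F).PosSemidef) :
    SepCAB (_root_.tensC_AB 1 E + _root_.tensC_AB P F) := by
  have h := ((SepCAB.tensC_AB (posSemidef_one_add_of_involution hP hP2) hadd).add
    (SepCAB.tensC_AB (posSemidef_one_sub_of_involution hP hP2) hsub)).smul
    (r := 1 / 2) (by norm_num)
  convert h using 1
  ext i j
  simp [_root_.tensC_AB]
  ring

theorem SepCAB.one_add_tens_involution {P : Matrix (Fin 2) (Fin 2) ℂ}
    {Q : Matrix (Fin 2 × Fin 2) (Fin 2 × Fin 2) ℂ} (hP : P.IsHermitian) (hP2 : P * P = 1)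
    (hQ : Q.IsHermitian) (hQ2 : Q * Q = 1) :
    SepCAB (_root_.tensC_AB 1 1 + _root_.tensC_AB P Q) :=
  .one_tens_add_tens hP hP2 (posSemidef_one_add_of_involution hQ hQ2)
    (posSemidef_one_sub_of_involution hQ hQ2)

theorem σX_isHermitian : σX.IsHermitian := by
  ext i j; fin_cases i <;> fin_cases j <;> simp [σX]

theorem σY_isHermitian : σY.IsHermitian := by
  ext i j; fin_cases i <;> fin_cases j <;> simp [σY]

theorem σZ_isHermitian : σZ.IsHermitian := by
  ext i j; fin_cases i <;> fin_cases j <;> simp [σZ]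

theorem σX_mul_self : σX * σX = 1 := by
  ext i j; fin_cases i <;> fin_cases j <;> simp [σX, mul_apply]

theorem σY_mul_self : σY * σY = 1 := by
  ext i j; fin_cases i <;> fin_cases j <;> simp [σY, mul_apply]

theorem σZ_mul_self : σZ * σZ = 1 := by
  ext i j; fin_cases i <;> fin_cases j <;> simp [σZ, mul_apply]

theorem Matrix.IsHermitian.kronecker {m n : Type*} {P : Matrix m m ℂ} {Q : Matrix n n ℂ}
    (hP : P.IsHermitian) (hQ : Q.IsHermitian) : (P ⊗ₖ Q).IsHermitian := by
  rw [IsHermitian, conjTranspose_kronecker, hP.eq, hQ.eq]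

theorem kronecker_mul_self_eq_one {P Q : Matrix (Fin 2) (Fin 2) ℂ}
    (hP : P * P = 1) (hQ : Q * Q = 1) : (P ⊗ₖ Q) * (P ⊗ₖ Q) = 1 := by
  rw [← mul_kronecker_mul, hP, hQ, one_kronecker_one]

/-- A Bell-diagonal state has nonnegative expectation in the singlet. -/
theorem add_le_one_of_bellDiag_posSemidef {a b c : ℝ} (h : (bellDiag a b c).PosSemidef) :
    a + b + c ≤ 1 := by
  have h' := h.dotProduct_mulVec_nonneg
    (fun i => if i = (0, 1) then 1 else if i = (1, 0) then -1 else 0)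
  simp [dotProduct, mulVec, Fintype.sum_prod_type, Fin.sum_univ_two, bellDiag, σX, σY, σZ,
    one_apply] at h'
  have hre := (Complex.le_def.mp h').1
  simp at hre
  linarith

/-- The Pauli expansion of the state. -/
theorem rhoABC_eq (a b c s : ℝ) :
    rhoABC a b c s = ((1 / 8 : ℝ) : ℂ) • (tensC_AB 1 1 + (b : ℂ) • tensC_AB 1 (σZ ⊗ₖ σZ)
      + (s : ℂ) • tensC_AB σX (σZ ⊗ₖ 1) + ((s * b : ℝ) : ℂ) • tensC_AB σX (1 ⊗ₖ σZ)
      + (a : ℂ) • tensC_AB σZ (σX ⊗ₖ σX) + (c : ℂ) • tensC_AB σZ (σY ⊗ₖ σY)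
      + ((s * a : ℝ) : ℂ) • tensC_AB σY (σY ⊗ₖ σX)
      - ((s * c : ℝ) : ℂ) • tensC_AB σY (σX ⊗ₖ σY)) := by
  have hZ : CZCA = diagonal fun i => if i.1 = 1 ∧ i.2.1 = 1 then -1 else 1 := by
    ext i j
    simp [CZCA, diagonal_apply]
  ext ⟨i, j, k⟩ ⟨i', j', k'⟩
  rw [rhoABC, hZ, mul_diagonal, diagonal_mul]
  fin_cases i <;> fin_cases j <;> fin_cases k <;> fin_cases i' <;> fin_cases j' <;>
    fin_cases k' <;>
    simp [tensC_AB, rhoC, bellDiag, σX, σY, σZ, one_apply] <;> ring_nf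

/-- The partial transpose has nonnegative expectation in
`|0⟩ ⊗ (|01⟩ - |10⟩) - |1⟩ ⊗ (|01⟩ + |10⟩)`. -/
theorem le_of_ptC_rhoABC_posSemidef {a b c s : ℝ} (h : (ptC (rhoABC a b c s)).PosSemidef) :
    (a + c) * (1 + s) ≤ (1 - b) * (1 - s) := by
  have h' := h.dotProduct_mulVec_nonneg (fun i =>
    if i = (0, 0, 1) then 1 else if i = (0, 1, 0) then -1 else if i = (1, 0, 1) then -1 else
      if i = (1, 1, 0) then -1 else 0)
  rw [rhoABC_eq] at h'
  simp [dotProduct, mulVec, Fintype.sum_prod_type, Fin.sum_univ_two, ptC, tensC_AB, σX, σY, σZ,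
    one_apply] at h'
  have hre := (Complex.le_def.mp h').1
  simp at hre
  linarith

/-- if the partial transpose of ρ_ABC over qubit C is positive semidefinite
(with all s_x ≥ 0 and s ≥ 0), then ρ_ABC is separable across C | AB. -/
theorem stmt12 (s01 s10 s11 s : ℝ)
    (h01 : 0 ≤ s01) (h10 : 0 ≤ s10) (h11 : 0 ≤ s11) (hs0 : 0 ≤ s) (hs1 : s ≤ 1)
    (hAB : (bellDiag s01 s10 s11).PosSemidef)
    (hppt : (ptC (rhoABC s01 s10 s11 s)).PosSemidef) :
    SepCAB (rhoABC s01 s10 s11 s) := by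
  have hsum := add_le_one_of_bellDiag_posSemidef hAB
  have hle := le_of_ptC_rhoABC_posSemidef hppt
  have hb : 0 ≤ 1 - s10 := by linarith
  have hI : SepCAB (tensC_AB 1 1) := .tensC_AB .one .one
  have hZZ : (1 + σZ ⊗ₖ σZ).PosSemidef :=
    posSemidef_one_add_of_involution (σZ_isHermitian.kronecker σZ_isHermitian)
      (kronecker_mul_self_eq_one σZ_mul_self σZ_mul_self)
  have hXZ : SepCAB (tensC_AB 1 1 + tensC_AB σX (σZ ⊗ₖ 1)) :=
    .one_add_tens_involution σX_isHermitian σX_mul_self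
      (σZ_isHermitian.kronecker isHermitian_one)
      (kronecker_mul_self_eq_one σZ_mul_self (mul_one 1))
  have hZXX : SepCAB (tensC_AB 1 1 + tensC_AB σZ (σX ⊗ₖ σX)) :=
    .one_add_tens_involution σZ_isHermitian σZ_mul_self
      (σX_isHermitian.kronecker σX_isHermitian)
      (kronecker_mul_self_eq_one σX_mul_self σX_mul_self)
  have hZYY : SepCAB (tensC_AB 1 1 + tensC_AB σZ (σY ⊗ₖ σY)) :=
    .one_add_tens_involution σZ_isHermitian σZ_mul_self
      (σY_isHermitian.kronecker σY_isHermitian)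
      (kronecker_mul_self_eq_one σY_mul_self σY_mul_self)
  have hYYX : SepCAB (tensC_AB 1 1 + tensC_AB σY (σY ⊗ₖ σX)) :=
    .one_add_tens_involution σY_isHermitian σY_mul_self
      (σY_isHermitian.kronecker σX_isHermitian)
      (kronecker_mul_self_eq_one σY_mul_self σX_mul_self)
  have hYXY : SepCAB (tensC_AB 1 1 + tensC_AB σY (-(σX ⊗ₖ σY))) :=
    .one_add_tens_involution σY_isHermitian σY_mul_self
      (σX_isHermitian.kronecker σY_isHermitian).neg
      (by rw [neg_mul_neg, kronecker_mul_self_eq_one σX_mul_self σY_mul_self])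
  have hEF : SepCAB (tensC_AB 1 (1 + σZ ⊗ₖ σZ) + tensC_AB σX (σZ ⊗ₖ 1 + 1 ⊗ₖ σZ)) := by
    refine .one_tens_add_tens σX_isHermitian σX_mul_self ?_ ?_
    · have : 1 + σZ ⊗ₖ σZ + (σZ ⊗ₖ 1 + 1 ⊗ₖ σZ) = (1 + σZ) ⊗ₖ (1 + σZ) := by
        rw [add_kronecker, kronecker_add, kronecker_add, one_kronecker_one]
        abel
      rw [this]
      exact (posSemidef_one_add_of_involution σZ_isHermitian σZ_mul_self).kronecker
        (posSemidef_one_add_of_involution σZ_isHermitian σZ_mul_self)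
    · have : 1 + σZ ⊗ₖ σZ - (σZ ⊗ₖ 1 + 1 ⊗ₖ σZ) = (1 - σZ) ⊗ₖ (1 - σZ) := by
        rw [sub_eq_add_neg 1 σZ, add_kronecker, kronecker_add, kronecker_add, one_kronecker_one]
        simp only [← neg_one_smul ℂ σZ, smul_kronecker, kronecker_smul]
        module
      rw [this]
      exact (posSemidef_one_sub_of_involution σZ_isHermitian σZ_mul_self).kronecker
        (posSemidef_one_sub_of_involution σZ_isHermitian σZ_mul_self)
  rw [rhoABC_eq]
  refine SepCAB.smul ?_ (by norm_num)
  have key := ((((((((hI.smul (sub_nonneg.mpr hle)).add (hXZ.smul (mul_nonneg hb hs0))).add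
    (hZXX.smul h01)).add (hZYY.smul h11)).add (hYYX.smul (mul_nonneg hs0 h01))).add
    (hYXY.smul (mul_nonneg hs0 h11))).add
    ((SepCAB.tensC_AB .one hZZ).smul (mul_nonneg h10 (sub_nonneg.mpr hs1)))).add
    (hEF.smul (mul_nonneg h10 hs0)))
  convert key using 1
  ext i j
  simp [tensC_AB]
  ring
end
end

section
/- Let M be an 8×8 Hermitian matrix, diagonal in the graph-state basis of the path C–A–B, whose partial transpose over qubit B has a negative eigenvalue with eigenvector Z_x|ψ⟩. Then applying the projection P = |0⟩⟨ψ'_{x'}| + |1⟩⟨ψ'_{x'}|Z_A (where |ψ'_{x'}⟩ is the corresponding two-vertex graph state on C, A and Z_A acts on the neighbour of B) to qubits C, A yields a 4×4 operator whose partial transpose has a negative eigenvalue. -/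
open Matrix Kronecker Complex ComplexOrder

noncomputable section

/-- the vector |+⟩⊗|+⟩ on qubits C, A -/
def plus2 : Fin 2 × Fin 2 → ℂ := fun _ => ((1 : ℂ) / Real.sqrt 2) ^ 2

/-- controlled-phase gate on the two qubits C, A -/
def CZ2 : Matrix (Fin 2 × Fin 2) (Fin 2 × Fin 2) ℂ :=
  fun i j => if i = j then (if i.1 = 1 ∧ i.2 = 1 then -1 else 1) else 0

/-- the graph states |ψ'_{x'}⟩ of the two-vertex chain C–A -/
def psi2 (x' : Bool × Bool) : Fin 2 × Fin 2 → ℂ :=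
  (((if x'.1 then σZ else 1) ⊗ₖ (if x'.2 then σZ else 1)) * CZ2).mulVec plus2

/-- the projection P = |0⟩⟨ψ'_{x'}| + |1⟩⟨ψ'_{x'}|Z_A acting on qubits C, A -/
def projP (x' : Bool × Bool) : Matrix (Fin 2) (Fin 2 × Fin 2) ℂ :=
  fun i j => if i = 0 then star (psi2 x' j)
             else star ((((1 : Matrix (Fin 2) (Fin 2) ℂ) ⊗ₖ σZ).mulVec (psi2 x')) j)

/-- the projection P lifted to the three-qubit space (identity on qubit B) -/
def projP3 (x' : Bool × Bool) : Matrix (Fin 2 × Fin 2) Q3 ℂ :=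
  fun i j => projP x' i.1 (j.1, j.2.1) * (if i.2 = j.2.2 then 1 else 0)

/-- the Bell-type vector (|00⟩ ± |11⟩)/√2 on two qubits, with the minus sign when `b` holds -/
def bellVec (b : Bool) : Fin 2 × Fin 2 → ℂ := fun i =>
  if i.1 = i.2 then (if i.1 = 1 ∧ b then -1 else 1) * ((1 : ℂ) / Real.sqrt 2) else 0

lemma one_div_sqrt_two_sq : ((1 : ℂ) / Real.sqrt 2) ^ 2 = 1 / 2 := by
  rw [div_pow, ← Complex.ofReal_pow, Real.sq_sqrt (by norm_num)]
  norm_num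

lemma psi2_apply (x' : Bool × Bool) (j : Fin 2 × Fin 2) :
    psi2 x' j = (if x'.1 ∧ j.1 = 1 then -1 else 1) * (if x'.2 ∧ j.2 = 1 then -1 else 1) *
      (if j.1 = 1 ∧ j.2 = 1 then -1 else 1) * (1 / 2) := by
  obtain ⟨a, b⟩ := x'
  obtain ⟨i, j⟩ := j
  have h := one_div_sqrt_two_sq
  cases a <;> cases b <;> fin_cases i <;> fin_cases j <;>
    simp [psi2, plus2, CZ2, σZ, Matrix.mulVec, dotProduct, Matrix.mul_apply,
      Fintype.sum_prod_type, Matrix.kroneckerMap_apply, Matrix.one_apply] at h ⊢ <;>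
    exact h

lemma projP_apply (x' : Bool × Bool) (i : Fin 2) (j : Fin 2 × Fin 2) :
    projP x' i j = (if i = 1 ∧ j.2 = 1 then -1 else 1) * psi2 x' j := by
  have hr : star (psi2 x' j) = psi2 x' j := by
    rw [psi2_apply]
    split_ifs <;> simp
  have hz : ((1 : Matrix (Fin 2) (Fin 2) ℂ) ⊗ₖ σZ).mulVec (psi2 x') j =
      (if j.2 = 1 then -1 else 1) * psi2 x' j := by
    obtain ⟨k, l⟩ := j
    fin_cases k <;> fin_cases l <;>
      simp [σZ, Matrix.mulVec, dotProduct, Fintype.sum_prod_type, Matrix.kroneckerMap_apply]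
  unfold projP
  rw [hz]
  fin_cases i
  · simpa using hr
  · by_cases h : j.2 = 1 <;> simpa [h] using hr

lemma grState_apply (x : Bool × Bool × Bool) (i : Q3) :
    grState x i = (if x.2.2 ∧ i.2.2 = 1 then -1 else 1) *
      (if i.2.1 = 1 ∧ i.2.2 = 1 then -1 else 1) * psi2 (x.1, x.2.1) (i.1, i.2.1) *
        ((1 : ℂ) / Real.sqrt 2) := by
  obtain ⟨a, b, c⟩ := x
  obtain ⟨i, j, k⟩ := i
  rw [psi2_apply, ← one_div_sqrt_two_sq]
  generalize hw : (1 : ℂ) / Real.sqrt 2 = w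
  have hψ : ∀ i : Q3, ψG i = (if i.2.1 = 1 ∧ i.2.2 = 1 then -1 else 1) *
      (if i.1 = 1 ∧ i.2.1 = 1 then -1 else 1) * w ^ 3 := by
    rintro ⟨i, j, k⟩
    fin_cases i <;> fin_cases j <;> fin_cases k <;>
      simp [ψG, plus3, CZCA, CZAB, Matrix.mulVec, dotProduct, Matrix.mul_apply,
        Fintype.sum_prod_type, ← hw]
  have hZ : ∀ (a : Bool) (i j : Fin 2), (if a then σZ else 1) i j =
      if i = j then (if a ∧ i = 1 then -1 else 1) else 0 := by
    intro a i j
    cases a <;> fin_cases i <;> fin_cases j <;> simp [σZ]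
  simp only [grState, Zop, op3, Matrix.mulVec, dotProduct, hZ, hψ, Fintype.sum_prod_type,
    Fin.sum_univ_two]
  fin_cases i <;> fin_cases j <;> fin_cases k <;>
    cases a <;> cases b <;> cases c <;> simp [pow_succ]

lemma projP3_mul_conjTranspose (x' : Bool × Bool) : projP3 x' * (projP3 x')ᴴ = 1 := by
  ext ⟨i, k⟩ ⟨j, l⟩
  obtain ⟨a, b⟩ := x'
  simp only [Matrix.mul_apply, Matrix.conjTranspose_apply, projP3, projP_apply, psi2_apply,
    Fintype.sum_prod_type, Fin.sum_univ_two]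
  cases a <;> cases b <;> fin_cases i <;> fin_cases j <;> fin_cases k <;> fin_cases l <;>
    simp <;> norm_num

lemma projP3_conjTranspose_mulVec_bellVec (x : Bool × Bool × Bool) :
    (projP3 (x.1, x.2.1))ᴴ.mulVec (bellVec x.2.2) = grState x := by
  ext ⟨i, j, k⟩
  have hr : star (psi2 (x.1, x.2.1) (i, j)) = psi2 (x.1, x.2.1) (i, j) := by
    rw [psi2_apply]
    split_ifs <;> simp
  rw [grState_apply]
  simp only [Matrix.mulVec, dotProduct, Matrix.conjTranspose_apply, projP3, projP_apply,
    bellVec, Fintype.sum_prod_type, Fin.sum_univ_two, star_mul', hr]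
  fin_cases j <;> fin_cases k <;> cases x.2.2 <;> simp

lemma pt2_projP3_conj (x' : Bool × Bool) (M : Matrix Q3 Q3 ℂ) :
    pt2 (projP3 x' * M * (projP3 x')ᴴ) = projP3 x' * ptB M * (projP3 x')ᴴ := by
  ext ⟨i, k⟩ ⟨j, l⟩
  simp only [pt2, ptB, Matrix.mul_apply, Matrix.conjTranspose_apply, projP3,
    Fintype.sum_prod_type, star_mul', apply_ite star, star_one, star_zero]
  simp [mul_ite, ite_mul]

lemma bellVec_ne_zero (b : Bool) : bellVec b ≠ 0 := by
  intro h
  simpa [bellVec] using congrFun h (0, 0)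

/-- localisation step of Lemma 1, R = B: if a graph-diagonal Hermitian M
has a partial transpose over B with a negative eigenvalue whose eigenvector is Z_x|ψ⟩,
then applying P to qubits C, A yields a two-qubit operator whose partial transpose has a
negative eigenvalue. -/
theorem stmt18 (M : Matrix Q3 Q3 ℂ) (hM : M.IsHermitian)
    (hdiag : ∀ x : Bool × Bool × Bool, ∃ c : ℝ, M.mulVec (grState x) = (c : ℂ) • grState x)
    (x : Bool × Bool × Bool) (μ : ℝ) (hμ : μ < 0)
    (hev : (ptB M).mulVec (grState x) = (μ : ℂ) • grState x) :
    ∃ μ' : ℝ, μ' < 0 ∧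
      (μ' : ℂ) ∈ spectrum ℂ
        (pt2 (projP3 (x.1, x.2.1) * M * (projP3 (x.1, x.2.1))ᴴ)) := by
  refine ⟨μ, hμ, ?_⟩
  rw [pt2_projP3_conj, ← Matrix.spectrum_toLin']
  refine Module.End.HasEigenvalue.mem_spectrum
    (Module.End.hasEigenvalue_of_hasEigenvector (x := bellVec x.2.2)
      ⟨Module.End.mem_eigenspace_iff.2 ?_, bellVec_ne_zero _⟩)
  rw [Matrix.toLin'_apply, ← Matrix.mulVec_mulVec, ← Matrix.mulVec_mulVec,
    projP3_conjTranspose_mulVec_bellVec, hev, Matrix.mulVec_smul,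
    ← projP3_conjTranspose_mulVec_bellVec, Matrix.mulVec_mulVec, projP3_mul_conjTranspose,
    Matrix.one_mulVec]
end
end
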